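/- arXiv:1907.03200 — 3 statements merged into one kernel-verified Lean document; each statement's English description precedes it below -/
import Mathlib

section
/- Let a, b > 0 and define M̂(t) = (a t + b t²)/(1 + ln(t² + 1)) for t ∈ [0, ∞), and let M(t) = M̂′(t) be its derivative. Then M is continuous on [0, ∞) and satisfies conditions (M₁) and (M₂): there exists m₀ > 0 such that M(t) ≥ m₀ for all t ≥ 0, and there exist positive constants σ₁ and σ₂ such that σ₂(t² + t) ≥ M̂(t) ≥ (1/2) M(t) t + σ₁ t for all t ≥ 0. -/
lemma one_le_one_add_log_sq (t : ℝ) : 1 ≤ 1 + Real.log (t ^ 2 + 1) := by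
  have := Real.log_nonneg (show (1 : ℝ) ≤ t ^ 2 + 1 by nlinarith [sq_nonneg t])
  linarith

lemma one_add_log_sq_sq_le {t : ℝ} (ht : 0 ≤ t) :
    (1 + Real.log (t ^ 2 + 1)) ^ 2 ≤ 16 * (1 + t) := by
  have h1 : Real.log (t ^ 2 + 1) ≤ Real.log ((1 + t) ^ 2) :=
    Real.log_le_log (by positivity) (by nlinarith)
  have h2 : Real.log ((1 + t) ^ 2) = 2 * Real.log (1 + t) := by
    rw [Real.log_pow]; norm_num
  have h3 : Real.log √(1 + t) = Real.log (1 + t) / 2 := Real.log_sqrt (by linarith)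
  have h4 := Real.log_le_sub_one_of_pos (Real.sqrt_pos.2 (show 0 < 1 + t by linarith))
  have h5 := Real.sq_sqrt (show 0 ≤ 1 + t by linarith)
  have h6 := one_le_one_add_log_sq t
  have h7 : 1 + Real.log (t ^ 2 + 1) ≤ 4 * √(1 + t) := by linarith
  calc (1 + Real.log (t ^ 2 + 1)) ^ 2 ≤ (4 * √(1 + t)) ^ 2 :=
        pow_le_pow_left₀ (by linarith) h7 2
    _ = 16 * (1 + t) := by rw [mul_pow, h5]; norm_num

lemma half_le_log_sub_one_add_two_div {s : ℝ} (hs : 0 < s) :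
    1 / 2 ≤ Real.log s - 1 + 2 / s := by
  have h1 := Real.one_sub_inv_le_log_of_pos (half_pos hs)
  rw [Real.log_div hs.ne' two_ne_zero, inv_div] at h1
  have := Real.log_two_gt_d9
  linarith

lemma hasDerivAt_quadratic_div_one_add_log (a b t : ℝ) :
    HasDerivAt (fun t : ℝ => (a * t + b * t ^ 2) / (1 + Real.log (t ^ 2 + 1)))
      (((a + 2 * b * t) * (1 + Real.log (t ^ 2 + 1)) -
        (a * t + b * t ^ 2) * (2 * t / (t ^ 2 + 1))) / (1 + Real.log (t ^ 2 + 1)) ^ 2) t := by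
  have hD := one_le_one_add_log_sq t
  have h1 : HasDerivAt (fun t : ℝ => a * t + b * t ^ 2) (a + 2 * b * t) t := by
    refine (((hasDerivAt_id t).const_mul a).add
      ((hasDerivAt_pow 2 t).const_mul b)).congr_deriv ?_
    norm_num
    ring
  have h2 : HasDerivAt (fun t : ℝ => t ^ 2 + 1) (2 * t) t := by
    simpa using (hasDerivAt_pow 2 t).add_const 1
  exact h1.div ((h2.log (by positivity)).const_add 1) (by linarith)

/-- For `M̂(t) = (a t + b t²)/(1 + ln(t² + 1))` with `a, b > 0` and
`M = M̂′`, the function `M` is continuous on `[0, ∞)` and satisfies (M₁) and (M₂). -/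
theorem kirchhoff_log_example_satisfies_M1_M2
    (a b : ℝ) (ha : 0 < a) (hb : 0 < b)
    (Mhat : ℝ → ℝ)
    (hMhat : ∀ t, Mhat t = (a * t + b * t ^ 2) / (1 + Real.log (t ^ 2 + 1)))
    (M : ℝ → ℝ) (hM : ∀ t, M t = deriv Mhat t) :
    (ContinuousOn M (Set.Ici 0) ∧ ∃ m₀ > (0:ℝ), ∀ t ≥ (0:ℝ), M t ≥ m₀) ∧
    (∃ σ₁ > (0:ℝ), ∃ σ₂ > (0:ℝ), ∀ t ≥ (0:ℝ),
      σ₂ * (t ^ 2 + t) ≥ Mhat t ∧ Mhat t ≥ (1 / 2) * M t * t + σ₁ * t) := by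
  have hMf : M = fun t => ((a + 2 * b * t) * (1 + Real.log (t ^ 2 + 1)) -
      (a * t + b * t ^ 2) * (2 * t / (t ^ 2 + 1))) / (1 + Real.log (t ^ 2 + 1)) ^ 2 := by
    funext t
    rw [hM, funext hMhat]
    exact (hasDerivAt_quadratic_div_one_add_log a b t).deriv
  have hpos : ∀ t : ℝ, 0 < 1 + Real.log (t ^ 2 + 1) := fun t =>
    zero_lt_one.trans_le (one_le_one_add_log_sq t)
  have hs : ∀ t : ℝ, 0 < t ^ 2 + 1 := fun t => by positivity
  set c := min a b
  have hc0 : 0 < c := lt_min ha hb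
  have hca : c ≤ a := min_le_left a b
  have hcb : c ≤ b := min_le_right a b
  refine ⟨⟨?_, c / 32, by positivity, fun t ht => ?_⟩,
    c / 64, by positivity, a + b, by positivity, fun t ht => ⟨?_, ?_⟩⟩
  · rw [hMf]
    have hlog : Continuous fun t : ℝ => Real.log (t ^ 2 + 1) :=
      Continuous.log (by fun_prop) fun t => (hs t).ne'
    have hfrac : Continuous fun t : ℝ => 2 * t / (t ^ 2 + 1) :=
      Continuous.div (by fun_prop) (by fun_prop) fun t => (hs t).ne'
    exact (Continuous.div (by fun_prop) (by fun_prop)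
      fun t => (pow_pos (hpos t) 2).ne').continuousOn
  · rw [hMf, ge_iff_le]
    beta_reduce
    rw [le_div_iff₀ (pow_pos (hpos t) 2)]
    have hsq := one_add_log_sq_sq_le ht
    have h1 := half_le_log_sub_one_add_two_div (hs t)
    have h2 := Real.one_sub_inv_le_log_of_pos (hs t)
    have hnum : (a + 2 * b * t) * (1 + Real.log (t ^ 2 + 1)) -
        (a * t + b * t ^ 2) * (2 * t / (t ^ 2 + 1)) =
        a * (Real.log (t ^ 2 + 1) - 1 + 2 / (t ^ 2 + 1)) +
          2 * b * t * (Real.log (t ^ 2 + 1) + (t ^ 2 + 1)⁻¹) := by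
      have := (hs t).ne'
      field_simp
      ring
    rw [hnum]
    calc c / 32 * (1 + Real.log (t ^ 2 + 1)) ^ 2 ≤ c / 32 * (16 * (1 + t)) := by gcongr
      _ ≤ a * (1 / 2) + 2 * b * t * 1 := by nlinarith
      _ ≤ _ := by gcongr; linarith
  · rw [hMhat, ge_iff_le, div_le_iff₀ (hpos t)]
    calc a * t + b * t ^ 2 ≤ (a + b) * (t ^ 2 + t) * 1 := by
          nlinarith [mul_nonneg ha.le (sq_nonneg t), mul_nonneg hb.le ht]
      _ ≤ _ := by gcongr; exact one_le_one_add_log_sq t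
  · have hsq := one_add_log_sq_sq_le ht
    have hD := one_le_one_add_log_sq t
    have hp := hpos t
    have hst := hs t
    have hcube : t - 1 / 2 ≤ t * (t ^ 2 / (t ^ 2 + 1)) := by
      rw [← mul_div_assoc, le_div_iff₀ hst]
      nlinarith [sq_nonneg (t - 1)]
    have hq : 0 ≤ t ^ 2 / (t ^ 2 + 1) := by positivity
    have hdiff : Mhat t - 1 / 2 * M t * t =
        t * ((a / 2 * (1 + Real.log (t ^ 2 + 1)) + a * (t ^ 2 / (t ^ 2 + 1)) +
          b * (t * (t ^ 2 / (t ^ 2 + 1)))) / (1 + Real.log (t ^ 2 + 1)) ^ 2) := by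
      rw [hMhat, hMf]
      have := hp.ne'
      have := hst.ne'
      field_simp
      ring
    have hmain : c / 64 ≤ (a / 2 * (1 + Real.log (t ^ 2 + 1)) + a * (t ^ 2 / (t ^ 2 + 1)) +
        b * (t * (t ^ 2 / (t ^ 2 + 1)))) / (1 + Real.log (t ^ 2 + 1)) ^ 2 := by
      rw [le_div_iff₀ (pow_pos hp 2)]
      have htq : 0 ≤ t * (t ^ 2 / (t ^ 2 + 1)) := mul_nonneg ht hq
      calc c / 64 * (1 + Real.log (t ^ 2 + 1)) ^ 2 ≤ c / 64 * (16 * (1 + t)) := by gcongr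
        _ ≤ c / 2 * 1 + 0 + c * (t * (t ^ 2 / (t ^ 2 + 1))) := by nlinarith
        _ ≤ _ := by gcongr; positivity
    have := mul_le_mul_of_nonneg_left hmain ht
    linarith
end

section
/- Let N be a positive integer, let μ be Lebesgue measure on ℝᴺ, and let X be a finite-dimensional subspace of L²(ℝᴺ, μ). Then there exists ϑ₀ > 0 such that for every u ∈ X with u ≠ 0: μ({x ∈ ℝᴺ : |u(x)| ≥ ϑ₀ ‖u‖_{L²}}) ≥ ϑ₀. -/
open MeasureTheory

open scoped Topology ENNReal

namespace MeasureTheory.Lp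

variable {α E : Type*} {m : MeasurableSpace α} {μ : Measure α} [NormedAddCommGroup E]
  {p : ℝ≥0∞}

/-- A nonzero element of `Lp` is bounded below in norm on a set of positive measure. -/
theorem exists_pos_ofReal_le_measure_norm_ge {v : Lp E p μ} (hv : v ≠ 0) :
    ∃ c > (0 : ℝ), ENNReal.ofReal c ≤ μ {x | c ≤ ‖v x‖} := by
  by_contra! h
  refine hv ((Lp.eq_zero_iff_ae_eq_zero).2 ?_)
  have hzero : ∀ n : ℕ, μ {x | 1 / ((n : ℝ) + 1) ≤ ‖v x‖} = 0 := by
    intro n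
    refine le_antisymm (ENNReal.le_of_forall_pos_le_add fun ε hε _ => ?_) zero_le
    have hc : 0 < min (1 / ((n : ℝ) + 1)) ε := lt_min (by positivity) (by exact_mod_cast hε)
    calc μ {x | 1 / ((n : ℝ) + 1) ≤ ‖v x‖}
        ≤ μ {x | min (1 / ((n : ℝ) + 1)) ε ≤ ‖v x‖} :=
          measure_mono fun x (hx : _ ≤ ‖v x‖) => Set.mem_ofPred.2 ((min_le_left _ _).trans hx)
      _ ≤ ENNReal.ofReal (min (1 / ((n : ℝ) + 1)) ε) := (h _ hc).le
      _ ≤ ENNReal.ofReal ε := ENNReal.ofReal_le_ofReal (min_le_right _ _)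
      _ = 0 + ε := by simp
  have hall : ∀ᵐ x ∂μ, ∀ n : ℕ, ‖v x‖ < 1 / ((n : ℝ) + 1) := by
    refine ae_all_iff.2 fun n => ?_
    simpa [ae_iff] using hzero n
  filter_upwards [hall] with x hx
  by_contra hne
  obtain ⟨n, hn⟩ := exists_nat_one_div_lt (norm_pos_iff.2 hne)
  exact lt_asymm hn (hx n)

/-- The lower level-set bound of a nonzero element of `Lp` is locally uniform. -/
theorem exists_pos_eventually_ofReal_le_measure_norm_ge [Fact (1 ≤ p)] {v : Lp E p μ}
    (hv : v ≠ 0) :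
    ∃ c > (0 : ℝ), ∀ᶠ w in 𝓝 v, ENNReal.ofReal c ≤ μ {x | c ≤ ‖w x‖} := by
  obtain ⟨d, hd, hdv⟩ := exists_pos_ofReal_le_measure_norm_ge hv
  have hc : 0 < d / 2 := half_pos hd
  refine ⟨d / 2, hc, ?_⟩
  have hlim : TendstoInMeasure μ (fun w : Lp E p μ => (w : α → E)) (𝓝 v) v :=
    tendstoInMeasure_of_tendsto_Lp Filter.tendsto_id
  rw [tendstoInMeasure_iff_norm] at hlim
  filter_upwards [(hlim (d / 2) hc).eventually (ge_mem_nhds (ENNReal.ofReal_pos.2 hc))]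
    with w hw
  have hsub : {x | d ≤ ‖v x‖} ⊆ {x | d / 2 ≤ ‖w x‖} ∪ {x | d / 2 ≤ ‖w x - v x‖} := by
    intro x hx
    simp only [Set.mem_union, Set.mem_ofPred_eq] at hx ⊢
    by_contra! hlt
    have := norm_sub_norm_le (v x) (w x)
    rw [norm_sub_rev] at this
    linarith
  have hle : ENNReal.ofReal (d / 2) + ENNReal.ofReal (d / 2)
      ≤ μ {x | d / 2 ≤ ‖w x‖} + ENNReal.ofReal (d / 2) := by
    rw [← ENNReal.ofReal_add hc.le hc.le, add_halves]
    exact hdv.trans ((measure_mono hsub).trans ((measure_union_le _ _).trans (by gcongr)))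
  exact (ENNReal.add_le_add_iff_right ENNReal.ofReal_ne_top).1 hle

/-- The lower level-set bound is uniform on compact subsets of `Lp` not containing zero. -/
theorem exists_pos_forall_ofReal_le_measure_norm_ge_of_isCompact [Fact (1 ≤ p)]
    {K : Set (Lp E p μ)} (hK : IsCompact K) (h0 : 0 ∉ K) :
    ∃ c > (0 : ℝ), ∀ w ∈ K, ENNReal.ofReal c ≤ μ {x | c ≤ ‖w x‖} := by
  refine hK.induction_on (p := fun s => ∃ c > (0 : ℝ), ∀ w ∈ s,
    ENNReal.ofReal c ≤ μ {x | c ≤ ‖w x‖}) ⟨1, one_pos, by simp⟩ ?_ ?_ ?_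
  · rintro s t hst ⟨c, hc, h⟩
    exact ⟨c, hc, fun w hw => h w (hst hw)⟩
  · rintro s t ⟨c, hc, hs⟩ ⟨d, hd, ht⟩
    refine ⟨min c d, lt_min hc hd, ?_⟩
    rintro w (hw | hw)
    · exact (ENNReal.ofReal_le_ofReal (min_le_left c d)).trans
        ((hs w hw).trans (measure_mono fun x hx => (min_le_left c d).trans hx))
    · exact (ENNReal.ofReal_le_ofReal (min_le_right c d)).trans
        ((ht w hw).trans (measure_mono fun x hx => (min_le_right c d).trans hx))
  · intro v hv
    obtain ⟨c, hc, h⟩ :=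
      exists_pos_eventually_ofReal_le_measure_norm_ge (ne_of_mem_of_not_mem hv h0)
    exact ⟨_, mem_nhdsWithin_of_mem_nhds h, c, hc, fun w hw => hw⟩

end MeasureTheory.Lp

/-- On a finite-dimensional subspace `X` of `L²(ℝᴺ)` there is a
uniform `ϑ₀ > 0` such that every nonzero `u ∈ X` satisfies
`μ({x : |u(x)| ≥ ϑ₀‖u‖₂}) ≥ ϑ₀`. -/
theorem uniform_level_set_estimate
    (N : ℕ) (hN : 0 < N)
    (X : Submodule ℝ (Lp ℝ 2 (volume : Measure (EuclideanSpace ℝ (Fin N)))))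
    (hX : FiniteDimensional ℝ X) :
    ∃ ϑ₀ > (0:ℝ), ∀ u : Lp ℝ 2 (volume : Measure (EuclideanSpace ℝ (Fin N))),
      u ∈ X → u ≠ 0 →
      ENNReal.ofReal ϑ₀ ≤ volume {x : EuclideanSpace ℝ (Fin N) | ϑ₀ * ‖u‖ ≤ |u x|} := by
  have : ProperSpace X := FiniteDimensional.proper_real X
  obtain ⟨c, hc, h⟩ := Lp.exists_pos_forall_ofReal_le_measure_norm_ge_of_isCompact
    ((isCompact_sphere (0 : X) 1).image continuous_subtype_val) (by simp)
  refine ⟨c, hc, fun u hu hne => ?_⟩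
  have hpos : 0 < ‖u‖ := norm_pos_iff.2 hne
  have hmem : ‖u‖⁻¹ • u ∈ Subtype.val '' Metric.sphere (0 : X) 1 :=
    ⟨⟨‖u‖⁻¹ • u, X.smul_mem _ hu⟩, by simp [norm_smul, hpos.ne'], rfl⟩
  refine (h _ hmem).trans (measure_mono_ae ?_)
  filter_upwards [Lp.coeFn_smul ‖u‖⁻¹ u] with x hx hle
  change c ≤ ‖(‖u‖⁻¹ • u : Lp ℝ 2 _) x‖ at hle
  change c * ‖u‖ ≤ |u x|
  rw [hx, Pi.smul_apply, norm_smul, norm_inv, norm_norm, Real.norm_eq_abs,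
    inv_mul_eq_div, le_div_iff₀ hpos] at hle
  exact hle
end

section
/- Let N be a positive integer, let μ be Lebesgue measure on ℝᴺ, and let X be a finite-dimensional subspace of L²(ℝᴺ, μ). Suppose ϑ₀ > 0 is such that μ(Γ_{ϑ₀}(u)) ≥ ϑ₀ for every u ∈ X with u ≠ 0, where Γ_{ϑ₀}(u) = {x ∈ ℝᴺ : |u(x)| ≥ ϑ₀ ‖u‖_{L²}}. Then there exists κ > 0 such that for every u ∈ X with u ≠ 0: μ(Γ_{ϑ₀}(u) ∩ {x ∈ ℝᴺ : |x| ≤ κ}) ≥ (3/4) ϑ₀. -/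
open MeasureTheory

/-- A finite-dimensional subspace of `Lᵖ` is dominated pointwise by multiples of a single
nonnegative function in `Lᵖ`. -/
theorem exists_memLp_dominating_of_finiteDimensional {α : Type*} [MeasurableSpace α]
    {μ : Measure α} {p : ENNReal} [Fact (1 ≤ p)] (X : Submodule ℝ (Lp ℝ p μ))
    [FiniteDimensional ℝ X] :
    ∃ G : α → ℝ, Measurable G ∧ MemLp G p μ ∧ ∀ u ∈ X, ∀ᵐ x ∂μ, |u x| ≤ ‖u‖ * G x := by
  let b := Module.finBasis ℝ X
  let L : X →L[ℝ] (Fin (Module.finrank ℝ X) → ℝ) := b.equivFunL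
  have hmeas (i) : Measurable fun x => ‖(b i : Lp ℝ p μ) x‖ :=
    (Lp.stronglyMeasurable _).measurable.norm
  refine ⟨fun x => ‖L‖ * ∑ i, ‖(b i : Lp ℝ p μ) x‖,
    (Finset.measurable_fun_sum _ fun i _ => hmeas i).const_mul _,
    (memLp_finsetSum _ fun i _ => (Lp.memLp _).norm).const_mul _, fun u hu => ?_⟩
  have hsum : ∑ i, L ⟨u, hu⟩ i • (b i : Lp ℝ p μ) = u := by
    have h := congrArg X.subtype (b.sum_equivFun ⟨u, hu⟩)
    rwa [map_sum] at h
  have hsmul : ∀ᵐ x ∂μ, ∀ i, (L ⟨u, hu⟩ i • (b i : Lp ℝ p μ)) x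
      = L ⟨u, hu⟩ i * (b i : Lp ℝ p μ) x :=
    ae_all_iff.2 fun i => Lp.coeFn_smul _ _
  have hcoe : u =ᵐ[μ] fun x => ∑ i, (L ⟨u, hu⟩ i • (b i : Lp ℝ p μ)) x := by
    conv_lhs => rw [← hsum]
    exact Lp.coeFn_fun_finsetSum _ _
  filter_upwards [hcoe, hsmul] with x hx hs
  rw [hx, ← mul_assoc, Finset.mul_sum]
  refine (Finset.abs_sum_le_sum_abs _ _).trans (Finset.sum_le_sum fun i _ => ?_)
  rw [hs i, abs_mul, mul_comm ‖u‖]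
  exact mul_le_mul_of_nonneg_right
    ((norm_le_pi_norm (L ⟨u, hu⟩) i).trans (L.le_opNorm ⟨u, hu⟩)) (abs_nonneg _)

/-- A measurable set of finite measure has arbitrarily small measure outside large balls. -/
theorem exists_measure_inter_norm_le_compl_lt {E : Type*} [NormedAddCommGroup E]
    [MeasurableSpace E] [BorelSpace E] {μ : Measure E} {A : Set E} (hA : MeasurableSet A)
    (hfin : μ A ≠ ⊤) {ε : ENNReal} (hε : 0 < ε) :
    ∃ κ > (0 : ℝ), μ (A ∩ {x | ‖x‖ ≤ κ}ᶜ) < ε := by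
  have hm (n : ℕ) : MeasurableSet (A ∩ {x | ‖x‖ ≤ (n : ℝ)}ᶜ) :=
    hA.inter (measurableSet_le measurable_norm measurable_const).compl
  have hanti : Antitone fun n : ℕ => A ∩ {x | ‖x‖ ≤ (n : ℝ)}ᶜ := by
    intro m n hmn x hx
    exact ⟨hx.1, fun h => hx.2 (le_trans (α := ℝ) h (Nat.cast_le.2 hmn))⟩
  have hempty : ⋂ n : ℕ, A ∩ {x | ‖x‖ ≤ (n : ℝ)}ᶜ = ∅ := by
    refine Set.eq_empty_of_forall_notMem fun x hx => ?_
    obtain ⟨n, hn⟩ := exists_nat_ge ‖x‖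
    exact (Set.mem_iInter.1 hx n).2 hn
  have htend := tendsto_measure_iInter_atTop (μ := μ) (fun n => (hm n).nullMeasurableSet) hanti
    ⟨0, measure_ne_top_of_subset Set.inter_subset_left hfin⟩
  rw [hempty, measure_empty] at htend
  obtain ⟨n, hn, hpos⟩ :=
    ((htend.eventually (gt_mem_nhds hε)).and (Filter.eventually_gt_atTop 0)).exists
  exact ⟨n, Nat.cast_pos.2 hpos, hn⟩

/-- Given the uniform level-set estimate on a finite-dimensional
subspace `X` of `L²(ℝᴺ)`, there is a uniform radius `κ > 0` such that
`μ(Γ_{ϑ₀}(u) ∩ {|x| ≤ κ}) ≥ (3/4)ϑ₀` for every nonzero `u ∈ X`. -/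
theorem uniform_level_set_ball_estimate
    (N : ℕ) (hN : 0 < N)
    (X : Submodule ℝ (Lp ℝ 2 (volume : Measure (EuclideanSpace ℝ (Fin N)))))
    (hX : FiniteDimensional ℝ X)
    (ϑ₀ : ℝ) (hϑ₀ : 0 < ϑ₀)
    (hlevel : ∀ u : Lp ℝ 2 (volume : Measure (EuclideanSpace ℝ (Fin N))),
      u ∈ X → u ≠ 0 →
      ENNReal.ofReal ϑ₀ ≤ volume {x : EuclideanSpace ℝ (Fin N) | ϑ₀ * ‖u‖ ≤ |u x|}) :
    ∃ κ > (0:ℝ), ∀ u : Lp ℝ 2 (volume : Measure (EuclideanSpace ℝ (Fin N))),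
      u ∈ X → u ≠ 0 →
      ENNReal.ofReal (3 / 4 * ϑ₀) ≤
        volume ({x : EuclideanSpace ℝ (Fin N) | ϑ₀ * ‖u‖ ≤ |u x|} ∩
          {x : EuclideanSpace ℝ (Fin N) | ‖x‖ ≤ κ}) := by
  obtain ⟨G, hGm, hG, hdom⟩ := exists_memLp_dominating_of_finiteDimensional X
  have hA : MeasurableSet {x | ϑ₀ ≤ ‖G x‖} := measurableSet_le measurable_const hGm.norm
  have hfin : volume {x | ϑ₀ ≤ ‖G x‖} ≠ ⊤ := by
    have h := hG.meas_ge_lt_top two_ne_zero ENNReal.ofNat_ne_top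
      (ε := ϑ₀.toNNReal) (by simpa using hϑ₀)
    refine (lt_of_le_of_lt (measure_mono fun x hx => ?_) h).ne
    exact Real.toNNReal_le_iff_le_coe.2 hx
  obtain ⟨κ, hκ, htail⟩ := exists_measure_inter_norm_le_compl_lt hA hfin
    (ENNReal.ofReal_pos.2 (show 0 < ϑ₀ / 4 by positivity))
  refine ⟨κ, hκ, fun u hu hu0 => ?_⟩
  set Γ := {x | ϑ₀ * ‖u‖ ≤ |u x|}
  set B := {x : EuclideanSpace ℝ (Fin N) | ‖x‖ ≤ κ}
  have hle : volume (Γ ∩ Bᶜ) ≤ volume ({x | ϑ₀ ≤ ‖G x‖} ∩ Bᶜ) := by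
    refine measure_mono_ae ?_
    filter_upwards [hdom u hu] with x hx hxΓ
    refine ⟨le_trans ?_ (le_abs_self (G x)), hxΓ.2⟩
    have hxu : ϑ₀ * ‖u‖ ≤ |u x| := hxΓ.1
    exact le_of_mul_le_mul_right (by linarith) (norm_pos_iff.2 hu0)
  have hsplit : ENNReal.ofReal ϑ₀ ≤ volume (Γ ∩ B) + ENNReal.ofReal (ϑ₀ / 4) :=
    calc ENNReal.ofReal ϑ₀ ≤ volume Γ := hlevel u hu hu0
      _ ≤ volume (Γ ∩ B) + volume (Γ ∩ Bᶜ) := by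
        simpa [Set.sdiff_eq] using measure_le_inter_add_sdiff volume Γ B
      _ ≤ _ := by gcongr; exact hle.trans htail.le
  rw [show 3 / 4 * ϑ₀ = ϑ₀ - ϑ₀ / 4 by ring, ENNReal.ofReal_sub _ (by positivity)]
  exact tsub_le_iff_right.2 hsplit
end
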